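/- (Area of Varignon's parallelogram) volume (convexHull ℝ {midpoint ℝ A B, midpoint ℝ B C, midpoint ℝ C D, midpoint ℝ D A}) = (1/2) * volume (convexHull ℝ {A, B, C, D}); that is, Varignon's parallelogram of a convex quadrangle has half the area of the quadrangle. -/

import Mathlib

/-- The Euclidean plane. -/
noncomputable abbrev E : Type := EuclideanSpace ℝ (Fin 2)

open MeasureTheory in
/-- Description of the normalised quadrangle by inequalities. -/
theorem hull_quad (a b c d : ℝ) (ha : 0 < a) (hb : 0 < b) (hc : 0 < c) (hd : 0 < d) :
    convexHull ℝ ({(-b, 0), (0, -d), (a, 0), (0, c)} : Set (ℝ × ℝ)) =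
      {p | -d * min (1 + p.1 / b) (1 - p.1 / a) ≤ p.2 ∧
        p.2 ≤ c * min (1 + p.1 / b) (1 - p.1 / a)} := by
  have key : {p : ℝ × ℝ | -d * min (1 + p.1 / b) (1 - p.1 / a) ≤ p.2 ∧
        p.2 ≤ c * min (1 + p.1 / b) (1 - p.1 / a)} =
      {p : ℝ × ℝ | (-p.2 / d ≤ 1 + p.1 / b ∧ -p.2 / d ≤ 1 - p.1 / a) ∧
        (p.2 / c ≤ 1 + p.1 / b ∧ p.2 / c ≤ 1 - p.1 / a)} := by
    ext ⟨x, y⟩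
    simp only [Set.mem_ofPred_eq]
    rw [← le_min_iff, ← le_min_iff, div_le_iff₀ hd, div_le_iff₀ hc]
    constructor <;> rintro ⟨h1, h2⟩ <;> constructor <;> linarith
  rw [key]
  apply Set.Subset.antisymm
  · apply convexHull_min
    · intro p hp
      simp only [Set.mem_insert_iff, Set.mem_singleton_iff] at hp
      have e1 : 0 < a / b := by positivity
      have e2 : 0 < b / a := by positivity
      have e3 : 0 < c / d := by positivity
      have e4 : 0 < d / c := by positivity
      rcases hp with rfl | rfl | rfl | rfl <;>
        simp [neg_div, ha.ne', hb.ne', hc.ne', hd.ne'] <;>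
        first | linarith | (refine ⟨?_, ?_⟩ <;> linarith)
    · rintro ⟨x, y⟩ ⟨⟨h1, h2⟩, h3, h4⟩ ⟨x', y'⟩ ⟨⟨k1, k2⟩, k3, k4⟩ u v hu hv huv
      simp only [Set.mem_ofPred_eq, Prod.smul_mk, Prod.mk_add_mk, smul_eq_mul] at *
      obtain rfl : v = 1 - u := by linarith
      simp only [div_eq_mul_inv] at *
      refine ⟨⟨?_, ?_⟩, ?_, ?_⟩
      · linarith [mul_le_mul_of_nonneg_left h1 hu, mul_le_mul_of_nonneg_left k1 hv]
      · linarith [mul_le_mul_of_nonneg_left h2 hu, mul_le_mul_of_nonneg_left k2 hv]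
      · linarith [mul_le_mul_of_nonneg_left h3 hu, mul_le_mul_of_nonneg_left k3 hv]
      · linarith [mul_le_mul_of_nonneg_left h4 hu, mul_le_mul_of_nonneg_left k4 hv]
  · have hconv := convex_convexHull ℝ ({(-b, 0), (0, -d), (a, 0), (0, c)} : Set (ℝ × ℝ))
    have hsub := subset_convexHull ℝ ({(-b, 0), (0, -d), (a, 0), (0, c)} : Set (ℝ × ℝ))
    set H := convexHull ℝ ({(-b, 0), (0, -d), (a, 0), (0, c)} : Set (ℝ × ℝ))
    have pB : ((-b, 0) : ℝ × ℝ) ∈ H := hsub (by simp)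
    have pD : ((0, -d) : ℝ × ℝ) ∈ H := hsub (by simp)
    have pA : ((a, 0) : ℝ × ℝ) ∈ H := hsub (by simp)
    have pC : ((0, c) : ℝ × ℝ) ∈ H := hsub (by simp)
    have p0 : ((0, 0) : ℝ × ℝ) ∈ H := by
      have h : 0 < a + b := by positivity
      have := hconv pA pB (a := b / (a + b)) (b := a / (a + b)) (by positivity) (by positivity)
        (by field_simp; ring)
      convert this using 1
      ext <;> simp
      field_simp; ring
    have tri : ∀ P Q : ℝ × ℝ, P ∈ H → Q ∈ H → ∀ s t : ℝ, 0 ≤ s → 0 ≤ t → s + t ≤ 1 →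
        s • P + t • Q ∈ H := by
      intro P Q hP hQ s t hs ht hst
      rcases eq_or_lt_of_le (add_nonneg hs ht) with h | h
      · obtain rfl : s = 0 := by linarith
        obtain rfl : t = 0 := by linarith
        rw [zero_smul, zero_smul, add_zero]
        exact p0
      · have h1 := hconv hP hQ (a := s / (s + t)) (b := t / (s + t)) (by positivity)
          (by positivity) (by field_simp)
        have h2 := hconv p0 h1 (a := 1 - (s + t)) (b := s + t) (by linarith) h.le (by ring)
        convert h2 using 1
        rw [smul_add, smul_smul, smul_smul, mul_div_cancel₀ _ h.ne', mul_div_cancel₀ _ h.ne']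
        ext <;> simp
    rintro ⟨x, y⟩ ⟨⟨h1, h2⟩, h3, h4⟩
    simp only at h1 h2 h3 h4
    rcases le_total 0 x with hx | hx <;> rcases le_total 0 y with hy | hy
    · have := tri _ _ pA pC (x / a) (y / c) (by positivity) (by positivity) (by linarith)
      convert this using 1
      ext <;> simp <;> field_simp
    · have := tri _ _ pA pD (x / a) (-y / d) (by positivity)
        (div_nonneg (by linarith) hd.le) (by linarith)
      convert this using 1
      ext <;> simp <;> field_simp
    · have := tri _ _ pB pC (-x / b) (y / c) (div_nonneg (by linarith) hb.le)
        (by positivity) (by rw [neg_div]; linarith)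
      convert this using 1
      ext <;> simp <;> field_simp
    · have := tri _ _ pB pD (-x / b) (-y / d) (div_nonneg (by linarith) hb.le)
        (div_nonneg (by linarith) hd.le) (by rw [neg_div b x]; linarith)
      convert this using 1
      ext <;> simp <;> field_simp

open MeasureTheory in
theorem lintegral_tent (a b : ℝ) (ha : 0 < a) (hb : 0 < b) (hab : a + b = 1) :
    ∫⁻ x : ℝ, ENNReal.ofReal (min (1 + x / b) (1 - x / a)) = ENNReal.ofReal (1 / 2) := by
  have hcont : Continuous fun x : ℝ => min (1 + x / b) (1 - x / a) := by fun_prop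
  have h1 : ∫⁻ x : ℝ, ENNReal.ofReal (min (1 + x / b) (1 - x / a)) =
      ∫⁻ x in Set.Ioc (-b) a, ENNReal.ofReal (min (1 + x / b) (1 - x / a)) := by
    symm
    apply setLIntegral_eq_of_support_subset
    intro x hx
    simp only [Function.mem_support, ne_eq, ENNReal.ofReal_eq_zero, not_le, lt_min_iff] at hx
    obtain ⟨h1, h2⟩ := hx
    have h3 : x / a < 1 := by linarith
    have h4 : -x / b < 1 := by rw [neg_div]; linarith
    rw [div_lt_one ha] at h3
    rw [div_lt_one hb] at h4
    exact ⟨by linarith, h3.le⟩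
  rw [h1, ← ofReal_integral_eq_lintegral_ofReal]
  · congr 1
    rw [← intervalIntegral.integral_of_le (by linarith),
      ← intervalIntegral.integral_add_adjacent_intervals (b := 0)
        (hcont.intervalIntegrable _ _) (hcont.intervalIntegrable _ _)]
    have e1 : ∫ x in (-b)..0, min (1 + x / b) (1 - x / a) = ∫ x in (-b)..0, (1 + x / b) := by
      apply intervalIntegral.integral_congr
      intro x hx
      rw [Set.uIcc_of_le (by linarith)] at hx
      have : x / b ≤ 0 := div_nonpos_of_nonpos_of_nonneg hx.2 hb.le
      have : x / a ≤ 0 := div_nonpos_of_nonpos_of_nonneg hx.2 ha.le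
      exact min_eq_left (by linarith)
    have e2 : ∫ x in 0..a, min (1 + x / b) (1 - x / a) = ∫ x in 0..a, (1 - x / a) := by
      apply intervalIntegral.integral_congr
      intro x hx
      rw [Set.uIcc_of_le (by linarith)] at hx
      have : 0 ≤ x / b := div_nonneg hx.1 hb.le
      have : 0 ≤ x / a := div_nonneg hx.1 ha.le
      exact min_eq_right (by linarith)
    rw [e1, e2, intervalIntegral.integral_add (by simp) (Continuous.intervalIntegrable (by fun_prop) _ _),
      intervalIntegral.integral_sub (by simp) (Continuous.intervalIntegrable (by fun_prop) _ _)]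
    simp only [intervalIntegral.integral_div, integral_id, intervalIntegral.integral_const,
      smul_eq_mul]
    field_simp
    linear_combination a * b * hab
  · exact (hcont.integrableOn_Icc).mono_set Set.Ioc_subset_Icc_self
  · refine (ae_restrict_iff' measurableSet_Ioc).2 (Filter.Eventually.of_forall ?_)
    intro x hx
    have h3 : x / a ≤ 1 := by rw [div_le_one ha]; exact hx.2
    have h4 : -x / b ≤ 1 := by rw [div_le_one hb]; linarith [hx.1]
    rw [neg_div] at h4
    change (0 : ℝ) ≤ min (1 + x / b) (1 - x / a)
    exact le_min (by linarith) (by linarith)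

open MeasureTheory in
theorem volume_quad (a b c d : ℝ) (ha : 0 < a) (hb : 0 < b) (hc : 0 < c) (hd : 0 < d)
    (hab : a + b = 1) (hcd : c + d = 1) :
    volume (convexHull ℝ ({(-b, 0), (0, -d), (a, 0), (0, c)} : Set (ℝ × ℝ))) =
      ENNReal.ofReal (1 / 2) := by
  rw [hull_quad a b c d ha hb hc hd, Measure.volume_eq_prod, Measure.prod_apply]
  · rw [← lintegral_tent a b ha hb hab]
    congr 1
    ext x
    have : Prod.mk x ⁻¹' {p : ℝ × ℝ | -d * min (1 + p.1 / b) (1 - p.1 / a) ≤ p.2 ∧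
        p.2 ≤ c * min (1 + p.1 / b) (1 - p.1 / a)} =
      Set.Icc (-d * min (1 + x / b) (1 - x / a)) (c * min (1 + x / b) (1 - x / a)) := rfl
    rw [this, Real.volume_Icc]
    congr 1
    linear_combination (min (1 + x / b) (1 - x / a)) * hcd
  · apply IsClosed.measurableSet
    have c1 : Continuous fun p : ℝ × ℝ => -d * min (1 + p.1 / b) (1 - p.1 / a) := by fun_prop
    have c2 : Continuous fun p : ℝ × ℝ => c * min (1 + p.1 / b) (1 - p.1 / a) := by fun_prop
    exact (isClosed_le c1 continuous_snd).inter (isClosed_le continuous_snd c2)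

open MeasureTheory in
theorem volume_rect (a b c d : ℝ) (ha : 0 < a) (hb : 0 < b) (hc : 0 < c) (hd : 0 < d)
    (hab : a + b = 1) (hcd : c + d = 1) :
    volume (convexHull ℝ ({(-b / 2, -d / 2), (a / 2, -d / 2), (a / 2, c / 2), (-b / 2, c / 2)} :
      Set (ℝ × ℝ))) = ENNReal.ofReal (1 / 4) := by
  have : ({(-b / 2, -d / 2), (a / 2, -d / 2), (a / 2, c / 2), (-b / 2, c / 2)} : Set (ℝ × ℝ)) =
      ({-b / 2, a / 2} : Set ℝ) ×ˢ ({-d / 2, c / 2} : Set ℝ) := by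
    ext ⟨x, y⟩
    simp only [Set.mem_insert_iff, Set.mem_singleton_iff, Prod.mk.injEq, Set.mem_prod]
    tauto
  rw [this, convexHull_prod, convexHull_pair, convexHull_pair, segment_eq_Icc (by linarith),
    segment_eq_Icc (by linarith), Measure.volume_eq_prod, Measure.prod_prod, Real.volume_Icc,
    Real.volume_Icc, ← ENNReal.ofReal_mul (by linarith)]
  congr 1
  have e1 : a / 2 - -b / 2 = 1 / 2 := by linarith
  have e2 : c / 2 - -d / 2 = 1 / 2 := by linarith
  rw [e1, e2]; norm_num

open MeasureTheory in
/-- Affine charts scale the area by a constant. -/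
theorem exists_scale (e : (ℝ × ℝ) ≃ₗ[ℝ] E) (O : E) :
    ∃ k : ENNReal, ∀ S : Set (ℝ × ℝ), volume ((fun p => O + e p) '' S) = k * volume S := by
  let L : (ℝ × ℝ) ≃L[ℝ] E := e.toContinuousLinearEquiv
  have : (Measure.map L.symm (volume : Measure E)).IsAddHaarMeasure :=
    L.symm.isAddHaarMeasure_map volume
  have h := Measure.isAddLeftInvariant_eq_smul (Measure.map L.symm (volume : Measure E))
    (volume : Measure (ℝ × ℝ))
  refine ⟨((Measure.map L.symm (volume : Measure E)).addHaarScalarFactor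
    (volume : Measure (ℝ × ℝ)) : NNReal), fun S => ?_⟩
  · have h1 : (fun p => O + e p) '' S = (fun x => O + x) '' (e '' S) := by
      rw [Set.image_image]
    have h2 : e '' S = L.symm.toHomeomorph.toMeasurableEquiv ⁻¹' S := by
      ext x
      constructor
      · rintro ⟨p, hp, rfl⟩
        change e.symm (e p) ∈ S
        simpa using hp
      · intro hx
        exact ⟨e.symm x, hx, by simp⟩
    rw [h1, Set.image_add_left, measure_preimage_add, h2, ← MeasurableEquiv.map_apply]
    exact congrArg (fun m : Measure (ℝ × ℝ) => m S) h

open MeasureTheory in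
/-- **Area of Varignon's parallelogram**: Varignon's parallelogram of a convex quadrangle
has half the area of the quadrangle. -/
theorem varignon_area (A B C D O : E)
    (hind : LinearIndependent ℝ ![C - A, D - B])
    (hO₁ : O ∈ openSegment ℝ A C) (hO₂ : O ∈ openSegment ℝ B D) :
    volume (convexHull ℝ
        ({midpoint ℝ A B, midpoint ℝ B C, midpoint ℝ C D, midpoint ℝ D A} : Set E)) =
      (1 / 2) * volume (convexHull ℝ ({A, B, C, D} : Set E)) := by
  obtain ⟨a, b, ha, hb, hab, h1⟩ := hO₁
  obtain ⟨c, d, hc, hd, hcd, h2⟩ := hO₂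
  let bs := basisOfLinearIndependentOfCardEqFinrank hind (by simp)
  let e : (ℝ × ℝ) ≃ₗ[ℝ] E := (LinearEquiv.finTwoArrow ℝ ℝ).symm ≪≫ₗ bs.equivFun.symm
  have he : ∀ x y : ℝ, e (x, y) = x • (C - A) + y • (D - B) := by
    intro x y
    simp [e, bs, Module.Basis.equivFun_symm_apply, Fin.sum_univ_two]
  obtain ⟨k, hk⟩ := exists_scale e O
  let F : (ℝ × ℝ) →ᵃ[ℝ] E := AffineMap.const ℝ (ℝ × ℝ) O + e.toLinearMap.toAffineMap
  have hF : ∀ S, F '' S = (fun p => O + e p) '' S := fun S => rfl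
  have hFp : ∀ x y : ℝ, F (x, y) = O + (x • (C - A) + y • (D - B)) := by
    intro x y
    rw [← he]; rfl
  obtain rfl : a = 1 - b := by linarith
  obtain rfl : c = 1 - d := by linarith
  have fA : F (-b, 0) = A := by rw [hFp, ← h1]; module
  have fC : F (1 - b, 0) = C := by rw [hFp, ← h1]; module
  have fB : F (0, -d) = B := by rw [hFp, ← h2]; module
  have fD : F (0, 1 - d) = D := by rw [hFp, ← h2]; module
  have m : ∀ p q r : ℝ × ℝ, midpoint ℝ p q = r → midpoint ℝ (F p) (F q) = F r := by
    rintro p q r rfl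
    exact (F.map_midpoint p q).symm
  have mAB : midpoint ℝ A B = F (-b / 2, -d / 2) := by
    rw [← fA, ← fB]; apply m; rw [midpoint_eq_smul_add]; ext <;> simp <;> ring
  have mBC : midpoint ℝ B C = F ((1 - b) / 2, -d / 2) := by
    rw [← fC, ← fB]; apply m; rw [midpoint_eq_smul_add]; ext <;> simp <;> ring
  have mCD : midpoint ℝ C D = F ((1 - b) / 2, (1 - d) / 2) := by
    rw [← fC, ← fD]; apply m; rw [midpoint_eq_smul_add]; ext <;> simp <;> ring
  have mDA : midpoint ℝ D A = F (-b / 2, (1 - d) / 2) := by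
    rw [← fA, ← fD]; apply m; rw [midpoint_eq_smul_add]; ext <;> simp <;> ring
  have s1 : ({A, B, C, D} : Set E) = F '' {(-b, 0), (0, -d), (1 - b, 0), (0, 1 - d)} := by
    simp only [Set.image_insert_eq, Set.image_singleton, fA, fB, fC, fD]
  rw [mAB, mBC, mCD, mDA, s1]
  have s2 : ({F (-b / 2, -d / 2), F ((1 - b) / 2, -d / 2), F ((1 - b) / 2, (1 - d) / 2),
      F (-b / 2, (1 - d) / 2)} : Set E) = F '' {(-b / 2, -d / 2), ((1 - b) / 2, -d / 2),
        ((1 - b) / 2, (1 - d) / 2), (-b / 2, (1 - d) / 2)} := by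
    simp only [Set.image_insert_eq, Set.image_singleton]
  rw [s2, ← AffineMap.image_convexHull, ← AffineMap.image_convexHull, hF, hF, hk, hk,
    volume_rect _ _ _ _ ha hb hc hd hab hcd, volume_quad _ _ _ _ ha hb hc hd hab hcd,
    mul_left_comm]
  congr 1
  have : (1 / 2 : ENNReal) = ENNReal.ofReal (1 / 2) := by
    rw [ENNReal.ofReal_div_of_pos (by norm_num)]; simp
  rw [this, ← ENNReal.ofReal_mul (by norm_num)]
  norm_num
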